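/- For every real p ≥ 2 there exists a constant C > 0, depending only on p, such that for all real numbers a ≥ 0 and b, one has |((a+b)⁺)^p − a^p − p a^{p−1} b| ≤ C (a^{p−2} b² + |b|^p), where t⁺ = max{t, 0} and a^{p−1}, a^{p−2} are interpreted as 0 when a = 0. -/

import Mathlib

lemma tangent_aux (q x y : ℝ) (hq : 1 ≤ q) (hx : 0 ≤ x) (hy : 0 ≤ y) :
    q * x ^ (q-1) * (y - x) ≤ y ^ q - x ^ q := by
  rcases hx.eq_or_lt with h | h
  · subst h
    rcases hq.eq_or_lt with h1 | h1
    · subst h1; simp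
    · rw [Real.zero_rpow (by linarith), Real.zero_rpow (by linarith)]
      simpa using Real.rpow_nonneg hy q
  · have hs : -1 ≤ y / x - 1 := by
      have := div_nonneg hy hx
      linarith
    have h2 := one_add_mul_self_le_rpow_one_add hs hq
    rw [add_sub_cancel, Real.div_rpow hy hx, le_div_iff₀ (Real.rpow_pos_of_pos h q)] at h2
    have h3 : x ^ q = x ^ (q-1) * x := by
      rw [Real.rpow_sub_one h.ne']; field_simp
    have h4 : (1 + q * (y / x - 1)) * x ^ q = x ^ q + q * x ^ (q-1) * (y - x) := by
      rw [h3]; field_simp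
    linarith

theorem stmt19 (p : ℝ) (hp : 2 ≤ p) :
    ∃ C > (0:ℝ), ∀ a b : ℝ, 0 ≤ a →
      |(max (a+b) 0) ^ p - a ^ p - p * a ^ (p-1) * b| ≤
        C * ((if a = 0 then 0 else a ^ (p-2)) * b ^ 2 + |b| ^ p) := by
  have hK : (1:ℝ) ≤ 2 ^ (p-2) := Real.one_le_rpow (by norm_num) (by linarith)
  have hC1 : 1 ≤ p * (p-1) := by nlinarith
  have hC : 1 ≤ p * (p-1) * 2 ^ (p-2) := by nlinarith
  refine ⟨p * (p-1) * 2 ^ (p-2), by linarith, ?_⟩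
  intro a b ha
  rcases ha.eq_or_lt with h | h
  · subst h
    rw [Real.zero_rpow (by linarith), Real.zero_rpow (by linarith)]
    simp only [zero_add, sub_zero, mul_zero, zero_mul, if_true]
    rw [abs_of_nonneg (Real.rpow_nonneg (le_max_right _ _) _)]
    have h1 : (max b 0) ^ p ≤ |b| ^ p :=
      Real.rpow_le_rpow (le_max_right _ _) (max_le (le_abs_self b) (abs_nonneg b)) (by linarith)
    have h2 : 0 ≤ |b| ^ p := Real.rpow_nonneg (abs_nonneg b) _
    nlinarith
  · rw [if_neg h.ne']
    set y := max (a+b) 0 with hy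
    have hy0 : 0 ≤ y := le_max_right _ _
    have hyb : b ≤ y - a := by have := le_max_left (a+b) 0; linarith
    have ha1 : 0 ≤ a ^ (p-1) := Real.rpow_nonneg ha _
    have hyp : y ^ (p-1) * (y - a) = y ^ (p-1) * b := by
      rcases le_total 0 (a+b) with h1 | h1
      · rw [hy, max_eq_left h1]; ring
      · rw [hy, max_eq_right h1, Real.zero_rpow (by linarith)]; ring
    have t1 := tangent_aux p a y (by linarith) ha hy0
    have t2 := tangent_aux p y a (by linarith) hy0 ha
    have hpa : 0 ≤ p * a ^ (p-1) := by positivity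
    have low : 0 ≤ y ^ p - a ^ p - p * a ^ (p-1) * b := by nlinarith
    rw [abs_of_nonneg low]
    have up : y ^ p - a ^ p - p * a ^ (p-1) * b ≤ p * ((y ^ (p-1) - a ^ (p-1)) * b) := by
      linear_combination t2 + p * hyp
    have e : p - 1 - 1 = p - 2 := by ring
    have mid : (y ^ (p-1) - a ^ (p-1)) * b ≤ (p-1) * (a + |b|) ^ (p-2) * b ^ 2 := by
      rcases le_total 0 b with hb | hb
      · have hye : y = a + b := by rw [hy, max_eq_left (by linarith)]
        have t3 := tangent_aux (p-1) y a (by linarith) hy0 ha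
        rw [e] at t3
        rw [abs_of_nonneg hb, ← hye]
        have : y ^ (p-1) - a ^ (p-1) ≤ (p-1) * y ^ (p-2) * b := by
          have : a - y = -b := by rw [hye]; ring
          rw [this] at t3; linarith
        nlinarith
      · have t3 := tangent_aux (p-1) a y (by linarith) ha hy0
        rw [e] at t3
        have hm : a ^ (p-2) ≤ (a + |b|) ^ (p-2) :=
          Real.rpow_le_rpow ha (by have := abs_nonneg b; linarith) (by linarith)
        have h0 : 0 ≤ a ^ (p-2) := Real.rpow_nonneg ha _
        have h1 : (p-1) * a ^ (p-2) * b ≤ y ^ (p-1) - a ^ (p-1) :=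
          le_trans (mul_le_mul_of_nonneg_left hyb (mul_nonneg (by linarith) h0)) t3
        have h2 := mul_le_mul_of_nonpos_right h1 hb
        have h3 : (p-1) * a ^ (p-2) * b ^ 2 ≤ (p-1) * (a + |b|) ^ (p-2) * b ^ 2 := by
          have : 0 ≤ p - 1 := by linarith
          gcongr
        linarith
    have hbp : |b| ^ (p-2) * b ^ 2 ≤ |b| ^ p := by
      rcases eq_or_ne b 0 with hb | hb
      · subst hb; simp; positivity
      · have : |b| ^ p = |b| ^ (p-2) * |b| ^ (2:ℝ) := by
          rw [← Real.rpow_add (abs_pos.mpr hb)]; ring_nf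
        rw [this, Real.rpow_two, sq_abs]
    have hM : (a + |b|) ^ (p-2) ≤ 2 ^ (p-2) * (a ^ (p-2) + |b| ^ (p-2)) := by
      have hb := abs_nonneg b
      have h0 : 0 ≤ a ^ (p-2) := Real.rpow_nonneg ha _
      have h0' : 0 ≤ |b| ^ (p-2) := Real.rpow_nonneg hb _
      rcases le_total a |b| with hab | hab
      · have := Real.rpow_le_rpow (by positivity) (show a + |b| ≤ 2 * |b| by linarith) (show 0 ≤ p - 2 by linarith)
        rw [Real.mul_rpow (by norm_num) hb] at this
        nlinarith
      · have := Real.rpow_le_rpow (by positivity) (show a + |b| ≤ 2 * a by linarith) (show 0 ≤ p - 2 by linarith)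
        rw [Real.mul_rpow (by norm_num) ha] at this
        nlinarith
    have hp0 : 0 ≤ p - 1 := by linarith
    calc _ ≤ p * ((y ^ (p-1) - a ^ (p-1)) * b) := up
      _ ≤ p * ((p-1) * (a + |b|) ^ (p-2) * b ^ 2) := by gcongr
      _ ≤ p * ((p-1) * (2 ^ (p-2) * (a ^ (p-2) + |b| ^ (p-2))) * b ^ 2) := by gcongr
      _ = p * (p-1) * 2 ^ (p-2) * (a ^ (p-2) * b ^ 2 + |b| ^ (p-2) * b ^ 2) := by ring
      _ ≤ _ := by gcongr
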